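/- For every integer t ≥ 4, the union of the two cyclic subgroups ⟨a⟩ and ⟨b·a⟩ of M_{2^t} (viewed as subsets) has exactly 3·2^(t-2) elements; in particular this union contains exactly 75% of the 2^t elements of M_{2^t}. -/

import Mathlib

/-- The multiplier `2^(t-2)+1` squares to `1` modulo `2^(t-1)` when `t ≥ 3`. -/
lemma Mmod.key (t : ℕ) (ht : 3 ≤ t) :
    ((2 ^ (t - 2) + 1 : ZMod (2 ^ (t - 1))) * (2 ^ (t - 2) + 1)) = 1 := by
  obtain ⟨s, rfl⟩ := Nat.exists_eq_add_of_le ht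
  have h2 : 3 + s - 2 = s + 1 := by omega
  have h3 : 3 + s - 1 = s + 2 := by omega
  rw [h2, h3]
  have h0 : ((2 ^ (s + 2) : ℕ) : ZMod (2 ^ (s + 2))) = 0 := ZMod.natCast_self _
  push_cast at h0
  linear_combination ((2 : ZMod (2 ^ (s + 2))) ^ s + 1) * h0

/-- The automorphism of `Multiplicative (ZMod (2^(t-1)))` given by multiplication of the
exponent by `2^(t-2)+1`. -/
def Mmod.uAut (t : ℕ) (ht : 3 ≤ t) :
    MulAut (Multiplicative (ZMod (2 ^ (t - 1)))) where
  toFun x := Multiplicative.ofAdd ((2 ^ (t - 2) + 1) * x.toAdd)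
  invFun x := Multiplicative.ofAdd ((2 ^ (t - 2) + 1) * x.toAdd)
  left_inv x := by
    simp only [toAdd_ofAdd, ← mul_assoc, Mmod.key t ht, one_mul,
      ofAdd_toAdd]
  right_inv x := by
    simp only [toAdd_ofAdd, ← mul_assoc, Mmod.key t ht, one_mul,
      ofAdd_toAdd]
  map_mul' x y := by
    simp only [toAdd_mul, mul_add, ofAdd_add]

lemma Mmod.uAut_sq (t : ℕ) (ht : 3 ≤ t) : (Mmod.uAut t ht) ^ 2 = 1 := by
  rw [pow_two]
  ext x
  show (Mmod.uAut t ht) ((Mmod.uAut t ht) x) = x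
  show Multiplicative.ofAdd ((2 ^ (t - 2) + 1) *
    (Multiplicative.ofAdd ((2 ^ (t - 2) + 1) * x.toAdd)).toAdd) = x
  simp only [toAdd_ofAdd, ← mul_assoc, Mmod.key t ht, one_mul,
    ofAdd_toAdd]

/-- The action of `ZMod 2` on `ZMod (2^(t-1))` by multiplication by `2^(t-2)+1`. -/
def Mmod.phi (t : ℕ) (ht : 3 ≤ t) :
    Multiplicative (ZMod 2) →* MulAut (Multiplicative (ZMod (2 ^ (t - 1)))) where
  toFun g := (Mmod.uAut t ht) ^ (g.toAdd.val)
  map_one' := by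
    show (Mmod.uAut t ht) ^ ((0 : ZMod 2).val) = 1
    simp
  map_mul' := fun g h => by
    show (Mmod.uAut t ht) ^ ((g.toAdd + h.toAdd).val) =
      (Mmod.uAut t ht) ^ (g.toAdd.val) * (Mmod.uAut t ht) ^ (h.toAdd.val)
    rw [ZMod.val_add, ← pow_eq_pow_mod _ (Mmod.uAut_sq t ht), pow_add]

/-- The modular maximal-cyclic group `M_{2^t}`, realized as the semidirect product
`(ZMod 2^(t-1)) ⋊ (ZMod 2)` where the nontrivial element of `ZMod 2` acts by
multiplication by `2^(t-2)+1`. -/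
abbrev Mmod (t : ℕ) (ht : 3 ≤ t) :=
  SemidirectProduct (Multiplicative (ZMod (2 ^ (t - 1)))) (Multiplicative (ZMod 2))
    (Mmod.phi t ht)

/-- The generator `a` of `M_{2^t}`. -/
def Mmod.a (t : ℕ) (ht : 3 ≤ t) : Mmod t ht :=
  SemidirectProduct.inl (Multiplicative.ofAdd (1 : ZMod (2 ^ (t - 1))))

/-- The generator `b` of `M_{2^t}`. -/
def Mmod.b (t : ℕ) (ht : 3 ≤ t) : Mmod t ht :=
  SemidirectProduct.inr (Multiplicative.ofAdd (1 : ZMod 2))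


open SemidirectProduct in
lemma Mmod.zpowers_a (t : ℕ) (ht : 3 ≤ t) :
    Subgroup.zpowers (Mmod.a t ht) = (rightHom : Mmod t ht →* _).ker := by
  rw [← range_inl_eq_ker_rightHom, MonoidHom.range_eq_map, Mmod.a, ← MonoidHom.map_zpowers]
  congr 1
  refine (Subgroup.eq_top_iff' _).2 fun x => Subgroup.mem_zpowers_iff.2 ⟨(x.toAdd.val : ℤ), ?_⟩
  rw [← ofAdd_zsmul]
  simp

lemma Mmod.card_eq (t : ℕ) (ht : 3 ≤ t) : Nat.card (Mmod t ht) = 2 ^ t := by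
  rw [SemidirectProduct.card, Nat.card_congr Multiplicative.toAdd,
    Nat.card_congr Multiplicative.toAdd, Nat.card_zmod, Nat.card_zmod, ← pow_succ]
  congr 1
  omega

lemma Mmod.card_zpowers_a (t : ℕ) (ht : 3 ≤ t) :
    Nat.card (Subgroup.zpowers (Mmod.a t ht)) = 2 ^ (t - 1) := by
  rw [Nat.card_zpowers, Mmod.a, orderOf_injective _ SemidirectProduct.inl_injective,
    orderOf_ofAdd_eq_addOrderOf, ZMod.addOrderOf_one]

lemma Mmod.b_mul_a_sq (t : ℕ) (ht : 3 ≤ t) :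
    (Mmod.b t ht * Mmod.a t ht) ^ 2 =
      SemidirectProduct.inl (Multiplicative.ofAdd (2 ^ (t - 2) + 2 : ZMod (2 ^ (t - 1)))) := by
  have h (x : Multiplicative (ZMod (2 ^ (t - 1)))) :
      Mmod.phi t ht (Multiplicative.ofAdd 1) x =
        Multiplicative.ofAdd ((2 ^ (t - 2) + 1) * x.toAdd) := by
    change (Mmod.uAut t ht ^ (1 : ZMod 2).val) x = _
    rw [ZMod.val_one, pow_one]
    rfl
  have hb : (Multiplicative.ofAdd 1 : Multiplicative (ZMod 2)) * Multiplicative.ofAdd 1 = 1 := rfl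
  rw [pow_two]
  refine SemidirectProduct.ext ?_ ?_
  · simp only [Mmod.a, Mmod.b, SemidirectProduct.mul_left, SemidirectProduct.mul_right,
      SemidirectProduct.left_inl, SemidirectProduct.right_inl, SemidirectProduct.left_inr,
      SemidirectProduct.right_inr, one_mul, mul_one, h, toAdd_ofAdd]
    rw [← ofAdd_add]
    apply congrArg Multiplicative.ofAdd
    linear_combination Mmod.key t ht
  · simp [Mmod.a, Mmod.b, hb]

lemma Mmod.orderOf_b_mul_a (t : ℕ) (ht3 : 3 ≤ t) (ht : 4 ≤ t) :
    orderOf (Mmod.b t ht3 * Mmod.a t ht3) = 2 ^ (t - 1) := by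
  obtain ⟨s, rfl⟩ := Nat.exists_eq_add_of_le ht
  have h1 : 4 + s - 1 = s + 2 + 1 := by omega
  have h2 : 4 + s - 2 = s + 2 := by omega
  have h0 : (2 : ZMod (2 ^ (4 + s - 1))) ^ (s + 3) = 0 := by
    have h := ZMod.natCast_self (2 ^ (4 + s - 1))
    push_cast at h
    rwa [h1] at h ⊢
  have hne : (2 : ZMod (2 ^ (4 + s - 1))) ^ (s + 2) ≠ 0 := by
    intro h
    have h' : ((2 ^ (s + 2) : ℕ) : ZMod (2 ^ (4 + s - 1))) = 0 := by exact_mod_cast h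
    rw [ZMod.natCast_eq_zero_iff, Nat.pow_dvd_pow_iff_le_right (by norm_num)] at h'
    omega
  have hpow (k : ℕ) : (Mmod.b (4 + s) ht3 * Mmod.a (4 + s) ht3) ^ (2 ^ (k + 1)) =
      SemidirectProduct.inl (Multiplicative.ofAdd
        (2 ^ k * (2 ^ (s + 2) + 2) : ZMod (2 ^ (4 + s - 1)))) := by
    rw [pow_succ', pow_mul, Mmod.b_mul_a_sq, ← map_pow, ← ofAdd_nsmul, nsmul_eq_mul]
    push_cast
    rw [h2]
  refine (orderOf_eq_prime_pow ?_ ?_).trans (congrArg (2 ^ ·) h1.symm)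
  · rw [hpow, ← map_one SemidirectProduct.inl, SemidirectProduct.inl_inj, ofAdd_eq_one]
    refine fun h => hne ?_
    linear_combination h - 2 ^ s * h0
  · rw [hpow, ← map_one SemidirectProduct.inl, SemidirectProduct.inl_inj, ofAdd_eq_one]
    linear_combination (2 ^ (s + 1) + 1) * h0

lemma Mmod.two_mul_card_inf (t : ℕ) (ht : 3 ≤ t) :
    2 * Nat.card (Subgroup.zpowers (Mmod.a t ht) ⊓
      Subgroup.zpowers (Mmod.b t ht * Mmod.a t ht) : Subgroup (Mmod t ht)) =
    Nat.card (Subgroup.zpowers (Mmod.b t ht * Mmod.a t ht)) := by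
  have h2 : (Subgroup.zpowers (Mmod.a t ht)).relIndex
      (Subgroup.zpowers (Mmod.b t ht * Mmod.a t ht)) = 2 := by
    rw [Mmod.zpowers_a, Subgroup.relIndex_ker, MonoidHom.map_zpowers, Nat.card_zpowers]
    simp [Mmod.a, Mmod.b, orderOf_ofAdd_eq_addOrderOf, ZMod.addOrderOf_one]
  rw [← Subgroup.inf_relIndex_right] at h2
  have h := Subgroup.relIndex_mul_relIndex ⊥ _ _ bot_le
    (inf_le_right : Subgroup.zpowers (Mmod.a t ht) ⊓
      Subgroup.zpowers (Mmod.b t ht * Mmod.a t ht) ≤ _)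
  rwa [h2, Subgroup.relIndex_bot_left, Subgroup.relIndex_bot_left, mul_comm] at h

/-- For every integer `t ≥ 4`, the union of the two cyclic subgroups `⟨a⟩` and `⟨b*a⟩` of
`M_{2^t}` (viewed as subsets) has exactly `3*2^(t-2)` elements; in particular this union
contains exactly 75% of the `2^t` elements of `M_{2^t}`. -/
theorem statement11 (t : ℕ) (ht3 : 3 ≤ t) (ht : 4 ≤ t) :
    Nat.card ((Subgroup.zpowers (Mmod.a t ht3) : Set (Mmod t ht3)) ∪
      (Subgroup.zpowers (Mmod.b t ht3 * Mmod.a t ht3) : Set (Mmod t ht3)) : Set (Mmod t ht3))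
      = 3 * 2 ^ (t - 2) ∧
    Nat.card (Mmod t ht3) = 2 ^ t ∧
    4 * Nat.card ((Subgroup.zpowers (Mmod.a t ht3) : Set (Mmod t ht3)) ∪
      (Subgroup.zpowers (Mmod.b t ht3 * Mmod.a t ht3) : Set (Mmod t ht3)) : Set (Mmod t ht3))
      = 3 * Nat.card (Mmod t ht3) := by
  have hcard := Mmod.card_eq t ht3
  have hunion : Nat.card ((Subgroup.zpowers (Mmod.a t ht3) : Set (Mmod t ht3)) ∪
      (Subgroup.zpowers (Mmod.b t ht3 * Mmod.a t ht3) : Set (Mmod t ht3)) : Set (Mmod t ht3))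
      = 3 * 2 ^ (t - 2) := by
    have : Finite (Mmod t ht3) := Nat.finite_of_card_ne_zero (by rw [hcard]; positivity)
    have hu := Set.ncard_union_add_ncard_inter
      (Subgroup.zpowers (Mmod.a t ht3) : Set (Mmod t ht3))
      (Subgroup.zpowers (Mmod.b t ht3 * Mmod.a t ht3) : Set (Mmod t ht3))
    rw [← Subgroup.coe_inf] at hu
    have hi := Mmod.two_mul_card_inf t ht3
    have ha := Mmod.card_zpowers_a t ht3
    have hc := Nat.card_zpowers (Mmod.b t ht3 * Mmod.a t ht3)
    rw [Mmod.orderOf_b_mul_a t ht3 ht] at hc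
    have hp : 2 ^ (t - 1) = 2 * 2 ^ (t - 2) := by
      rw [← pow_succ']
      congr 1
      omega
    simp only [← SetLike.coe_sort_coe, Nat.card_coe_set_eq] at ha hc hi ⊢
    omega
  refine ⟨hunion, hcard, ?_⟩
  rw [hunion, hcard, show t = t - 2 + 2 by omega, pow_add, Nat.add_sub_cancel]
  ring
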